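/- arXiv:1710.03830 — 6 statements merged into one kernel-verified Lean document; each statement's English description precedes it below -/
import Mathlib

section
/- Let φ ∈ Δ(B^n) and let ρ_1,…,ρ_n ∈ Δ(V). If there exists a private-value Bayes-correlated equilibrium ψ ∈ Δ(V^n × B^n) with Σ_{v∈V^n} ψ(v,b) = φ(b) for all b ∈ B^n and whose value-marginal for each player i equals ρ_i (i.e., Σ_{b∈B^n} Σ_{v∈V^n : v_i = v_i*} ψ(v,b) = ρ_i(v_i*) for all i and v_i* ∈ V), then there exist per-player conditional distributions x_i(·|b) ∈ Δ(V), for each bidder i and each b ∈ B^n, satisfying: (i) for every i, every v_i ∈ V and all b_i*, b_i' ∈ B, Σ_{b∈B^n : b_i = b_i*} φ(b)·x_i(v_i|b)·(u_i(b;v_i) − u_i(b_i', b_{−i}; v_i)) ≥ 0, and (ii) for every i and v_i ∈ V, ρ_i(v_i) = Σ_{b∈B^n} φ(b)·x_i(v_i|b). In particular, infeasibility of this per-player system refutes the hypothesis that the data arose from a BCE with independent private values with marginals ρ_1,…,ρ_n. -/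
open Finset

variable {n : ℕ} {B V : Type*}

/-- A probability mass function on a finite type. -/
def IsPMF {X : Type*} [Fintype X] (p : X → ℝ) : Prop :=
  (∀ x, 0 ≤ p x) ∧ ∑ x, p x = 1

/-- Best-response sum for a private-value distribution `ψ ∈ Δ(V^n × B^n)`. -/
noncomputable def pvBRSum [Fintype B] [Fintype V] [DecidableEq B] [DecidableEq V]
    (u : Fin n → (Fin n → B) → V → ℝ)
    (ψ : (Fin n → V) × (Fin n → B) → ℝ)
    (i : Fin n) (vstar : V) (bstar bdev : B) : ℝ :=
  ∑ z : (Fin n → V) × (Fin n → B),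
    if z.1 i = vstar ∧ z.2 i = bstar
    then ψ z * (u i z.2 vstar - u i (Function.update z.2 i bdev) vstar)
    else 0

/-- Private-value Bayes-correlated equilibrium. -/
def IsPVBCE [Fintype B] [Fintype V] [DecidableEq B] [DecidableEq V]
    (u : Fin n → (Fin n → B) → V → ℝ)
    (ψ : (Fin n → V) × (Fin n → B) → ℝ) : Prop :=
  ∀ (i : Fin n) (vstar : V) (bstar bdev : B), 0 ≤ pvBRSum u ψ i vstar bstar bdev

/-- if a private-value BCE has bid-marginal `φ` and per-player value marginals
`ρ i`, then the per-player system of conditional distributions `x i (·|b)` is feasible. -/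
theorem pv_bce_implies_per_player_lp_feasible
    [Fintype B] [Fintype V] [DecidableEq B] [DecidableEq V]
    (u : Fin n → (Fin n → B) → V → ℝ)
    (φ : (Fin n → B) → ℝ) (ρ : Fin n → V → ℝ)
    (hφ : IsPMF φ) (hρ : ∀ i, IsPMF (ρ i))
    (hexists : ∃ ψ : (Fin n → V) × (Fin n → B) → ℝ, IsPMF ψ ∧ IsPVBCE u ψ ∧
      (∀ b : Fin n → B, ∑ v : Fin n → V, ψ (v, b) = φ b) ∧
      (∀ (i : Fin n) (vstar : V),
        ∑ b : Fin n → B, ∑ v : Fin n → V,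
          (if v i = vstar then ψ (v, b) else 0) = ρ i vstar)) :
    ∃ x : Fin n → (Fin n → B) → V → ℝ,
      (∀ (i : Fin n) (b : Fin n → B), IsPMF (x i b)) ∧
      (∀ (i : Fin n) (vi : V) (bstar bdev : B),
        0 ≤ ∑ b : Fin n → B,
          if b i = bstar
          then φ b * x i b vi * (u i b vi - u i (Function.update b i bdev) vi)
          else 0) ∧
      (∀ (i : Fin n) (vi : V), ρ i vi = ∑ b : Fin n → B, φ b * x i b vi) := by
  obtain ⟨ψ, hψ, hbce, hb, hv⟩ := hexists
  set m : Fin n → (Fin n → B) → V → ℝ :=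
    fun i b w => ∑ v : Fin n → V, (if v i = w then ψ (v, b) else 0) with hm
  have hm0 : ∀ i b w, 0 ≤ m i b w := by
    intro i b w
    refine Finset.sum_nonneg fun v _ => ?_
    split_ifs
    · exact hψ.1 _
    · exact le_rfl
  have hmsum : ∀ i b, ∑ w, m i b w = φ b := by
    intro i b
    rw [← hb b]
    simp only [hm]
    rw [Finset.sum_comm]
    simp
  have hx : ∀ i b w,
      φ b * (if φ b = 0 then ρ i w else m i b w / φ b) = m i b w := by
    intro i b w
    split_ifs with h
    · have h1 := hmsum i b
      rw [h] at h1
      rw [(Finset.sum_eq_zero_iff_of_nonneg (fun w _ => hm0 i b w)).1 h1 w (Finset.mem_univ w), h,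
        zero_mul]
    · field_simp
  refine ⟨fun i b w => if φ b = 0 then ρ i w else m i b w / φ b, ?_, ?_, ?_⟩
  · intro i b
    by_cases h : φ b = 0
    · simpa [h] using hρ i
    · refine ⟨fun w => ?_, ?_⟩
      · simp only [h, if_false]
        exact div_nonneg (hm0 i b w) (hφ.1 b)
      · simp only [h, if_false]
        rw [← Finset.sum_div, hmsum, div_self h]
  · intro i w bs bd
    have key := hbce i w bs bd
    simp only [hx]
    unfold pvBRSum at key
    rw [Fintype.sum_prod_type_right] at key
    refine key.trans_eq (Finset.sum_congr rfl fun b _ => ?_)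
    by_cases hbi : b i = bs
    · simp only [hbi, and_true, if_true, hm, Finset.sum_mul, ite_mul, zero_mul]
    · simp [hbi]
  · intro i w
    simp only [hx]
    exact (hv i w).symm
end

section
/- Let G : ℝ → ℝ, let v, b ∈ ℝ, and suppose: (i) G is differentiable at b with derivative g := G'(b) ≠ 0; (ii) the function U(b') = (v − b')·G(b') has a local maximum at b' = b. Then v = b + G(b)/g. In particular, in a first price independent private values auction with continuous bids, if G_{−i}(·|b_i) denotes the conditional distribution function of the maximum opposing bid given bidder i's equilibrium bid b_i, with density g_{−i}(·|b_i), and the equilibrium bid b_i maximizes b' ↦ (v_i − b')·G_{−i}(b'|b_i), then the bidder's value is recovered as v_i = b_i + G_{−i}(b_i|b_i)/g_{−i}(b_i|b_i), so the value is point identified from the bid distribution. -/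
/-- first-order-condition inversion for first price auctions.  If `G` is
differentiable at `b` with nonzero derivative `g`, and `b' ↦ (v − b')·G(b')` (the interim
utility of bidding `b'` with value `v`) has a local maximum at `b' = b`, then the value is
point identified from the bid distribution: `v = b + G(b)/g`. -/
theorem value_inversion_first_price
    (G : ℝ → ℝ) (v b g : ℝ)
    (hG : HasDerivAt G g b) (hg : g ≠ 0)
    (hmax : IsLocalMax (fun b' : ℝ => (v - b') * G b') b) :
    v = b + G b / g := by
  have h := hmax.hasDerivAt_eq_zero (((hasDerivAt_id' b).const_sub v).mul hG)
  field_simp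
  linarith
end

section
/- Let n ≥ 2 be an integer and set α = (n−1)/n. Let H > 0, let v : [0,1] → ℝ be Lebesgue measurable with 0 ≤ v(y) ≤ H for all y, and let B : [0,1] → ℝ be integrable with R = ∫₀¹ B(q) dq ≥ 0. Suppose that for every q ∈ (0,1]: (1/q^α)·∫₀^q α·y^{α−1}·v(y) dy ≤ B(q). Then the mean μ = ∫₀¹ v(q) dq satisfies μ ≤ √( (2n/(n−1))·H·R ). -/
open MeasureTheory

/-- the BBM quantile inequality implies the upper bound
`μ ≤ √((2n/(n−1))·H·R)` on the mean of the common value. -/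
theorem bbm_mean_upper_bound
    (n : ℕ) (hn : 2 ≤ n) (α : ℝ) (hα : α = ((n : ℝ) - 1) / n)
    (H : ℝ) (hH : 0 < H) (v B : ℝ → ℝ)
    (hvmeas : Measurable v)
    (hv : ∀ y ∈ Set.Icc (0 : ℝ) 1, 0 ≤ v y ∧ v y ≤ H)
    (hB : IntervalIntegrable B volume 0 1)
    (R : ℝ) (hR : R = ∫ q in (0 : ℝ)..1, B q) (hR0 : 0 ≤ R)
    (hBBM : ∀ q ∈ Set.Ioc (0 : ℝ) 1,
      (1 / q ^ α) * ∫ y in (0 : ℝ)..q, α * y ^ (α - 1) * v y ≤ B q) :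
    (∫ q in (0 : ℝ)..1, v q) ≤ Real.sqrt (2 * n / ((n : ℝ) - 1) * H * R) := by
  have hn' : (2 : ℝ) ≤ n := by exact_mod_cast hn
  have hα0 : 0 < α := by rw [hα]; apply div_pos <;> linarith
  have hα1 : α < 1 := by rw [hα, div_lt_one (by linarith)]; linarith
  have vint01 : IntervalIntegrable v volume 0 1 := by
    apply IntervalIntegrable.mono_fun (intervalIntegrable_const (c := H))
      hvmeas.aestronglyMeasurable
    rw [Filter.EventuallyLE, ae_restrict_iff' measurableSet_uIoc]
    refine Filter.Eventually.of_forall fun y hy => ?_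
    rw [Set.uIoc_of_le zero_le_one] at hy
    have := hv y ⟨hy.1.le, hy.2⟩
    rw [Real.norm_of_nonneg this.1, Real.norm_of_nonneg hH.le]; exact this.2
  have vint : ∀ a b : ℝ, 0 ≤ a → a ≤ b → b ≤ 1 → IntervalIntegrable v volume a b := by
    intro a b ha hab hb
    apply vint01.mono_set
    rw [Set.uIcc_of_le hab, Set.uIcc_of_le zero_le_one]
    exact Set.Icc_subset_Icc ha hb
  have wint : ∀ q : ℝ, 0 < q → q ≤ 1 →
      IntervalIntegrable (fun y => α * y ^ (α - 1) * v y) volume 0 q := by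
    intro q hq hq1
    have h1 : IntervalIntegrable (fun y : ℝ => α * y ^ (α - 1) * H) volume 0 q :=
      ((intervalIntegral.intervalIntegrable_rpow' (by linarith)).const_mul α).mul_const H
    apply h1.mono_fun
    · exact Measurable.aestronglyMeasurable (by fun_prop)
    rw [Filter.EventuallyLE, ae_restrict_iff' measurableSet_uIoc]
    refine Filter.Eventually.of_forall fun y hy => ?_
    rw [Set.uIoc_of_le hq.le] at hy
    have := hv y ⟨hy.1.le, hy.2.trans hq1⟩
    simp only [norm_mul]
    rw [Real.norm_of_nonneg this.1, Real.norm_of_nonneg hH.le]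
    exact mul_le_mul_of_nonneg_left this.2 (by positivity)
  have hV0 : ∀ q ∈ Set.Ioc (0:ℝ) 1, 0 ≤ ∫ y in (0:ℝ)..q, v y := fun q hq =>
    intervalIntegral.integral_nonneg hq.1.le fun y hy => (hv y ⟨hy.1, hy.2.trans hq.2⟩).1
  have key : ∀ q ∈ Set.Ioc (0:ℝ) 1, α * (∫ y in (0:ℝ)..q, v y) ≤ B q := by
    intro q hq
    refine le_trans ?_ (hBBM q hq)
    have h1 : (∫ y in (0:ℝ)..q, α * q ^ (α - 1) * v y) ≤
        ∫ y in (0:ℝ)..q, α * y ^ (α - 1) * v y := by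
      apply intervalIntegral.integral_mono_on_of_le_Ioo hq.1.le
        ((vint 0 q le_rfl hq.1.le hq.2).const_mul _) (wint q hq.1 hq.2)
      intro y hy
      apply mul_le_mul_of_nonneg_right _ (hv y ⟨hy.1.le, hy.2.le.trans hq.2⟩).1
      apply mul_le_mul_of_nonneg_left _ hα0.le
      exact Real.rpow_le_rpow_of_nonpos hy.1 hy.2.le (by linarith)
    rw [intervalIntegral.integral_const_mul] at h1
    have hqa : 0 < q ^ α := Real.rpow_pos_of_pos hq.1 _
    rw [Real.rpow_sub hq.1, Real.rpow_one] at h1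
    rw [one_div, ← div_eq_inv_mul, le_div_iff₀ hqa]
    refine le_trans ?_ h1
    have h2 : q ^ α ≤ q ^ α / q := by
      rw [le_div_iff₀ hq.1]; nlinarith [hq.2]
    have := mul_le_mul_of_nonneg_left h2 (mul_nonneg hα0.le (hV0 q hq))
    linarith
  set μ := ∫ q in (0 : ℝ)..1, v q with hμ
  have hμ0 : 0 ≤ μ := hV0 1 ⟨one_pos, le_rfl⟩
  have hVlow : ∀ q ∈ Set.Ioc (0:ℝ) 1, μ - H * (1 - q) ≤ ∫ y in (0:ℝ)..q, v y := by
    intro q hq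
    have h1 := intervalIntegral.integral_add_adjacent_intervals
      (vint 0 q le_rfl hq.1.le hq.2) (vint q 1 hq.1.le hq.2 le_rfl)
    have h2 : (∫ y in q..1, v y) ≤ ∫ y in q..1, H :=
      intervalIntegral.integral_mono_on hq.2 (vint q 1 hq.1.le hq.2 le_rfl)
        intervalIntegrable_const fun y hy => (hv y ⟨hq.1.le.trans hy.1, hy.2⟩).2
    rw [intervalIntegral.integral_const, smul_eq_mul] at h2
    linarith
  have hμH : μ ≤ H := by
    have h2 : (∫ y in (0:ℝ)..1, v y) ≤ ∫ y in (0:ℝ)..1, H :=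
      intervalIntegral.integral_mono_on zero_le_one vint01
        intervalIntegrable_const fun y hy => (hv y hy).2
    simpa using h2
  obtain ⟨c, hc⟩ : ∃ c, c = 1 - μ / H := ⟨_, rfl⟩
  have hc0 : 0 ≤ c := by
    have := (div_le_one hH).2 hμH
    linarith
  have hc1 : c ≤ 1 := by
    have := div_nonneg hμ0 hH.le
    linarith
  have hB1 : IntervalIntegrable B volume 0 c := by
    apply hB.mono_set
    rw [Set.uIcc_of_le hc0, Set.uIcc_of_le zero_le_one]
    exact Set.Icc_subset_Icc le_rfl hc1
  have hB2 : IntervalIntegrable B volume c 1 := by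
    apply hB.mono_set
    rw [Set.uIcc_of_le hc1, Set.uIcc_of_le zero_le_one]
    exact Set.Icc_subset_Icc hc0 le_rfl
  have hsplit := intervalIntegral.integral_add_adjacent_intervals hB1 hB2
  have e1 : (∫ q in (0:ℝ)..c, (0:ℝ)) ≤ ∫ q in (0:ℝ)..c, B q := by
    apply intervalIntegral.integral_mono_on_of_le_Ioo hc0 intervalIntegrable_const hB1
    intro q hq
    have hq' : q ∈ Set.Ioc (0:ℝ) 1 := ⟨hq.1, hq.2.le.trans hc1⟩
    exact le_trans (mul_nonneg hα0.le (hV0 q hq')) (key q hq')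
  have e2 : (∫ q in c..1, (α * (μ - H) + (α * H) * q)) ≤ ∫ q in c..1, B q := by
    apply intervalIntegral.integral_mono_on_of_le_Ioo hc1
      (Continuous.intervalIntegrable (by fun_prop) _ _) hB2
    intro q hq
    have hq' : q ∈ Set.Ioc (0:ℝ) 1 := ⟨hc0.trans_lt hq.1, hq.2.le⟩
    have := mul_le_mul_of_nonneg_left (hVlow q hq') hα0.le
    linarith [key q hq']
  rw [intervalIntegral.integral_add (Continuous.intervalIntegrable (by fun_prop) _ _)
    (Continuous.intervalIntegrable (by fun_prop) _ _), intervalIntegral.integral_const,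
    intervalIntegral.integral_const_mul, integral_id, smul_eq_mul] at e2
  rw [intervalIntegral.integral_zero] at e1
  have e3 : α * μ ^ 2 / (2 * H) ≤ R := by
    have : (1 - c) * (α * (μ - H)) + α * H * ((1 ^ 2 - c ^ 2) / 2) = α * μ ^ 2 / (2 * H) := by
      rw [hc]; field_simp; ring
    linarith
  apply Real.le_sqrt_of_sq_le
  have e4 : 2 * n / ((n : ℝ) - 1) * H * R = 2 * H * R / α := by
    have : (n : ℝ) - 1 ≠ 0 := by linarith
    rw [hα]; field_simp
  rw [e4, le_div_iff₀ hα0]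
  rw [div_le_iff₀ (by positivity)] at e3
  linarith
end

section
/- Let α ∈ (0,1), H > 0, let v : [0,1] → ℝ be Lebesgue measurable with 0 ≤ v(y) ≤ H for all y, and let B : [0,1] → ℝ be integrable. Suppose that for every q ∈ (0,1]: (1/q^α)·∫₀^q α·y^{α−1}·v(y) dy ≤ B(q). Then ∫₀¹ v(y)·(y^{α−1} − 1) dy ≤ ((1−α)/α)·∫₀¹ B(q) dq. -/
open MeasureTheory

/-- integrating the pointwise BBM quantile inequality over `q ∈ [0,1]` yields
the single linear integral constraint `∫₀¹ v(y)·(y^{α−1} − 1) dy ≤ ((1−α)/α)·∫₀¹ B(q) dq`. -/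
theorem bbm_integrated_constraint
    (α : ℝ) (hα : α ∈ Set.Ioo (0 : ℝ) 1)
    (H : ℝ) (hH : 0 < H) (v B : ℝ → ℝ)
    (hvmeas : Measurable v)
    (hv : ∀ y ∈ Set.Icc (0 : ℝ) 1, 0 ≤ v y ∧ v y ≤ H)
    (hB : IntervalIntegrable B volume 0 1)
    (hBBM : ∀ q ∈ Set.Ioc (0 : ℝ) 1,
      (1 / q ^ α) * ∫ y in (0 : ℝ)..q, α * y ^ (α - 1) * v y ≤ B q) :
    (∫ y in (0 : ℝ)..1, v y * (y ^ (α - 1) - 1)) ≤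
      (1 - α) / α * ∫ q in (0 : ℝ)..1, B q := by
  obtain ⟨h0, h1⟩ := hα
  have h1' : 0 < 1 - α := by linarith
  set μ : Measure ℝ := volume.restrict (Set.Ioc (0 : ℝ) 1) with hμ
  set S : Set (ℝ × ℝ) := {p | p.2 ≤ p.1} with hS
  have hSm : MeasurableSet S := measurableSet_le measurable_snd measurable_fst
  set G : ℝ × ℝ → ℝ := fun p => p.1 ^ (-α) * (α * p.2 ^ (α - 1) * v p.2) with hG
  have hGm : Measurable G := by fun_prop
  have hi1 : Integrable (fun q : ℝ => q ^ (-α)) μ :=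
    (intervalIntegrable_iff_integrableOn_Ioc_of_le zero_le_one).1
      (intervalIntegral.intervalIntegrable_rpow' (by linarith))
  have hi2 : Integrable (fun y : ℝ => α * y ^ (α - 1) * v y) μ := by
    have hi : Integrable (fun y : ℝ => y ^ (α - 1)) μ :=
      (intervalIntegrable_iff_integrableOn_Ioc_of_le zero_le_one).1
        (intervalIntegral.intervalIntegrable_rpow' (by linarith))
    refine (hi.const_mul α).mul_bdd (c := H) hvmeas.aestronglyMeasurable ?_
    rw [hμ, ae_restrict_iff' measurableSet_Ioc]
    refine Filter.Eventually.of_forall fun y hy => ?_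
    have := hv y (Set.Ioc_subset_Icc_self hy)
    rw [Real.norm_eq_abs, abs_of_nonneg this.1]
    exact this.2
  have hGi : Integrable G (μ.prod μ) := hi1.mul_prod hi2
  have hfi : Integrable (S.indicator G) (μ.prod μ) := hGi.indicator hSm
  have hswap := integral_integral_swap (f := fun q y => S.indicator G (q, y)) hfi
  have hL : ∀ q ∈ Set.Ioc (0 : ℝ) 1, ∫ y, S.indicator G (q, y) ∂μ ≤ B q := by
    intro q hq
    refine le_trans (le_of_eq ?_) (hBBM q hq)
    have : (fun y => S.indicator G (q, y)) =
        (Set.Iic q).indicator (fun y => q ^ (-α) * (α * y ^ (α - 1) * v y)) := by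
      ext y
      simp [Set.indicator_apply, hS, hG]
    rw [this, integral_indicator measurableSet_Iic, hμ,
      Measure.restrict_restrict measurableSet_Iic, integral_const_mul,
      intervalIntegral.integral_of_le hq.1.le, Real.rpow_neg hq.1.le, one_div]
    congr 3
    ext y
    simp only [Set.mem_inter_iff, Set.mem_Iic, Set.mem_Ioc]
    have := hq.2
    constructor
    · rintro ⟨a, b, c⟩; exact ⟨b, a⟩
    · rintro ⟨a, b⟩; exact ⟨b, a, b.trans this⟩
  have hR : ∀ y ∈ Set.Ioc (0 : ℝ) 1,
      ∫ q, S.indicator G (q, y) ∂μ = α / (1 - α) * (v y * (y ^ (α - 1) - 1)) := by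
    intro y hy
    have : (fun q => S.indicator G (q, y)) =
        (Set.Ici y).indicator (fun q => q ^ (-α) * (α * y ^ (α - 1) * v y)) := by
      ext q
      simp [Set.indicator_apply, hS, hG]
    have hset : Set.Ici y ∩ Set.Ioc 0 1 = Set.Icc y 1 := by
      ext q
      simp only [Set.mem_inter_iff, Set.mem_Ici, Set.mem_Ioc, Set.mem_Icc]
      have := hy.1
      constructor
      · rintro ⟨a, b, c⟩; exact ⟨a, c⟩
      · rintro ⟨a, b⟩; exact ⟨a, this.trans_le a, b⟩
    rw [this, integral_indicator measurableSet_Ici, hμ,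
      Measure.restrict_restrict measurableSet_Ici, integral_mul_const, hset,
      integral_Icc_eq_integral_Ioc, ← intervalIntegral.integral_of_le hy.2,
      integral_rpow (Or.inl (by linarith))]
    have e : y ^ (α - 1) * y ^ (-α + 1) = 1 := by
      rw [← Real.rpow_add hy.1]; simp
    rw [Real.one_rpow, show -α + 1 = 1 - α by ring] at *
    field_simp
    linear_combination (-v y) * e
  have hmain : α / (1 - α) * (∫ y in (0 : ℝ)..1, v y * (y ^ (α - 1) - 1)) ≤
      ∫ q in (0 : ℝ)..1, B q := by
    rw [intervalIntegral.integral_of_le zero_le_one, intervalIntegral.integral_of_le zero_le_one,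
      ← integral_const_mul, ← setIntegral_congr_fun measurableSet_Ioc hR]
    refine hswap.symm.le.trans ?_
    exact setIntegral_mono_on hfi.integral_prod_left
      ((intervalIntegrable_iff_integrableOn_Ioc_of_le zero_le_one).1 hB) measurableSet_Ioc hL
  have := mul_le_mul_of_nonneg_left hmain (show 0 ≤ (1 - α) / α by positivity)
  refine le_trans (le_of_eq ?_) this
  field_simp
end

section
/- Let H > 0 and R ∈ [0,H]. Let v : [0,1] → ℝ be Lebesgue measurable with 0 ≤ v(y) ≤ H for all y, and suppose ∫₀¹ v(y)·(y^{−1/2} − 1) dy ≤ R. Then ∫₀¹ v(y) dy ≤ 2·√(R·H) − R. -/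
open MeasureTheory

lemma bbm_aux (H : ℝ) (hH : 0 < H) (v : ℝ → ℝ) (hvmeas : Measurable v)
    (hv : ∀ y ∈ Set.Icc (0 : ℝ) 1, 0 ≤ v y ∧ v y ≤ H) (s : ℝ) (hs : 0 < s) (hs1 : s ≤ 1)
    (hcon : (∫ y in (0 : ℝ)..1, v y * (y ^ (-(1 : ℝ) / 2) - 1)) ≤ H * s ^ 2) :
    (∫ y in (0 : ℝ)..1, v y) ≤ H * s * (2 - s) := by
  have hw : ∀ a b : ℝ, IntervalIntegrable (fun y : ℝ => y ^ (-(1 : ℝ) / 2)) volume a b :=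
    fun a b => intervalIntegral.intervalIntegrable_rpow' (by norm_num)
  have hb : ∀ᵐ y ∂(volume.restrict (Set.Ioc (0 : ℝ) 1)), ‖v y‖ ≤ H := by
    refine (ae_restrict_iff' measurableSet_Ioc).2 (Filter.Eventually.of_forall fun y hy => ?_)
    have := hv y ⟨hy.1.le, hy.2⟩
    rw [Real.norm_eq_abs, abs_of_nonneg this.1]
    exact this.2
  have hmul : ∀ f : ℝ → ℝ, IntervalIntegrable f volume 0 1 →
      IntervalIntegrable (fun y => v y * f y) volume 0 1 := by
    intro f hf
    rw [intervalIntegrable_iff_integrableOn_Ioc_of_le zero_le_one] at hf ⊢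
    exact Integrable.bdd_mul hf hvmeas.aestronglyMeasurable hb
  have hvi : IntervalIntegrable v volume 0 1 := by
    simpa using hmul (fun _ => 1) intervalIntegrable_const
  have hvw := hmul _ ((hw 0 1).sub (intervalIntegrable_const (c := (1 : ℝ))))
  obtain ⟨t, ht⟩ : ∃ t, t = 1 - s := ⟨_, rfl⟩
  have ht0 : 0 ≤ t := by linarith
  have ht1 : t ≤ 1 := by linarith
  have htt : t ^ 2 ≤ 1 := by nlinarith
  have hg : ∀ a b : ℝ, IntervalIntegrable (fun y : ℝ => 1 - t * y ^ (-(1 : ℝ) / 2)) volume a b :=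
    fun a b => intervalIntegrable_const.sub ((hw a b).const_mul t)
  have hvg := hmul _ (hg 0 1)
  have hpow : ∀ y : ℝ, 0 ≤ y → y ^ (-(1 : ℝ) / 2) = (√y)⁻¹ := by
    intro y hy
    rw [neg_div, Real.rpow_neg hy, Real.sqrt_eq_rpow]
  have hmem : t ^ 2 ∈ Set.uIcc (0 : ℝ) 1 := by
    rw [Set.uIcc_of_le zero_le_one]; exact ⟨by positivity, htt⟩
  have hvg1 : IntervalIntegrable (fun y => v y * (1 - t * y ^ (-(1 : ℝ) / 2))) volume 0 (t ^ 2) :=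
    hvg.mono_set (Set.uIcc_subset_uIcc_left hmem)
  have hvg2 : IntervalIntegrable (fun y => v y * (1 - t * y ^ (-(1 : ℝ) / 2))) volume (t ^ 2) 1 :=
    hvg.mono_set (Set.uIcc_subset_uIcc_right hmem)
  have h1 : ∫ y in (0 : ℝ)..(t ^ 2), v y * (1 - t * y ^ (-(1 : ℝ) / 2)) ≤ 0 := by
    have := intervalIntegral.integral_mono_on_of_le_Ioo (by positivity) hvg1
      (intervalIntegrable_const (c := (0 : ℝ))) (fun y hy => by
        have hy0 : 0 < √y := Real.sqrt_pos.2 hy.1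
        have hyt : √y ≤ t := (Real.sqrt_le_left ht0).2 hy.2.le
        rw [hpow y hy.1.le]
        have : 1 ≤ t * (√y)⁻¹ := by
          rw [← div_eq_mul_inv, le_div_iff₀ hy0]; linarith
        exact mul_nonpos_of_nonneg_of_nonpos (hv y ⟨hy.1.le, hy.2.le.trans htt⟩).1 (by linarith))
    simpa using this
  have h2 : ∫ y in (t ^ 2)..1, v y * (1 - t * y ^ (-(1 : ℝ) / 2)) ≤
      ∫ y in (t ^ 2)..1, H * (1 - t * y ^ (-(1 : ℝ) / 2)) := by
    refine intervalIntegral.integral_mono_on_of_le_Ioo htt hvg2 ((hg _ _).const_mul H) ?_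
    intro y hy
    have hyp : 0 < y := lt_of_le_of_lt (by positivity) hy.1
    have hy0 : 0 < √y := Real.sqrt_pos.2 hyp
    have hyt : t ≤ √y := Real.le_sqrt_of_sq_le hy.1.le
    rw [hpow y hyp.le]
    have : t * (√y)⁻¹ ≤ 1 := by
      rw [← div_eq_mul_inv, div_le_iff₀ hy0]; linarith
    exact mul_le_mul_of_nonneg_right (hv y ⟨hyp.le, hy.2.le⟩).2 (by linarith)
  have h3 : ∫ y in (t ^ 2)..1, H * (1 - t * y ^ (-(1 : ℝ) / 2)) = H * s ^ 2 := by
    rw [intervalIntegral.integral_const_mul, intervalIntegral.integral_sub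
      intervalIntegrable_const ((hw _ _).const_mul t), intervalIntegral.integral_const_mul,
      integral_rpow (Or.inl (by norm_num))]
    have e : (-(1 : ℝ) / 2 + 1) = 1 / 2 := by norm_num
    rw [e, ← Real.sqrt_eq_rpow, ← Real.sqrt_eq_rpow, Real.sqrt_sq ht0]
    simp only [intervalIntegral.integral_const, Real.sqrt_one, smul_eq_mul]
    rw [ht]; ring
  have h4 := intervalIntegral.integral_add_adjacent_intervals hvg1 hvg2
  have h5 : ∫ y in (0 : ℝ)..1, v y * (1 - t * y ^ (-(1 : ℝ) / 2)) =
      s * (∫ y in (0 : ℝ)..1, v y) - t * ∫ y in (0 : ℝ)..1, v y * (y ^ (-(1 : ℝ) / 2) - 1) := by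
    rw [← intervalIntegral.integral_const_mul, ← intervalIntegral.integral_const_mul,
      ← intervalIntegral.integral_sub (hvi.const_mul s) (hvw.const_mul t)]
    congr 1
    ext y
    rw [ht]; ring
  have h6 := mul_le_mul_of_nonneg_left hcon ht0
  have h7 : s * (∫ y in (0 : ℝ)..1, v y) ≤ s * (H * s * (2 - s)) := by
    have : s * (H * s * (2 - s)) = t * (H * s ^ 2) + H * s ^ 2 := by rw [ht]; ring
    linarith
  exact le_of_mul_le_mul_left h7 hs

/-- two-bidder bound on the mean of the common value from the integrated BBM
constraint: if `0 ≤ v ≤ H` and `∫₀¹ v(y)·(y^{−1/2} − 1) dy ≤ R` with `0 ≤ R ≤ H`, then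
`∫₀¹ v ≤ 2√(R·H) − R`. -/
theorem bbm_two_bidder_mean_bound
    (H R : ℝ) (hH : 0 < H) (hR : R ∈ Set.Icc (0 : ℝ) H)
    (v : ℝ → ℝ) (hvmeas : Measurable v)
    (hv : ∀ y ∈ Set.Icc (0 : ℝ) 1, 0 ≤ v y ∧ v y ≤ H)
    (hcon : (∫ y in (0 : ℝ)..1, v y * (y ^ (-(1 : ℝ) / 2) - 1)) ≤ R) :
    (∫ y in (0 : ℝ)..1, v y) ≤ 2 * Real.sqrt (R * H) - R := by
  obtain ⟨hR0, hRH⟩ := hR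
  rcases hR0.eq_or_lt with h0 | h0
  · subst h0
    simp only [zero_mul, Real.sqrt_zero, mul_zero, sub_zero]
    by_contra! hI
    obtain ⟨I, hIe⟩ : ∃ I, I = ∫ y in (0 : ℝ)..1, v y := ⟨_, rfl⟩
    rw [← hIe] at hI
    have hs : 0 < min 1 (I / (4 * H)) := lt_min one_pos (by positivity)
    have key := bbm_aux H hH v hvmeas hv _ hs (min_le_left _ _) (hcon.trans (by positivity))
    rw [← hIe] at key
    have h2 := min_le_right 1 (I / (4 * H))
    rw [le_div_iff₀ (by positivity)] at h2
    nlinarith [mul_pos hH (mul_pos hs hs)]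
  · have hs : 0 < √(R / H) := Real.sqrt_pos.2 (by positivity)
    have hsq : √(R / H) ^ 2 = R / H := Real.sq_sqrt (by positivity)
    have hHs : H * √(R / H) ^ 2 = R := by rw [hsq]; field_simp
    have key := bbm_aux H hH v hvmeas hv _ hs
      (Real.sqrt_le_one.2 ((div_le_one hH).2 hRH)) (hcon.trans hHs.ge)
    have e : √(R * H) = H * √(R / H) := by
      rw [Real.sqrt_eq_iff_mul_self_eq (by positivity) (by positivity)]
      linear_combination -H * hHs
    rw [e]
    linarith
end

section
/- Let H > 0 and 0 ≤ b* ≤ H. Set θ = ((H − b*)/H)² and define v : [0,1] → ℝ by v(y) = H if y ≥ θ and v(y) = 0 otherwise. Then: (i) for every q ∈ (0,1], (1/√q)·∫₀^q (v(y)/(2√y)) dy ≤ b*; and (ii) ∫₀¹ v(y) dy = 2·b* − (b*)²/H. -/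
open MeasureTheory

lemma aux_cut (θ q : ℝ) (f : ℝ → ℝ) (h0 : 0 ≤ θ) (hq : θ ≤ q) :
    (∫ y in (0 : ℝ)..q, (if θ ≤ y then f y else 0)) = ∫ y in θ..q, f y := by
  rw [intervalIntegral.integral_of_le (h0.trans hq), intervalIntegral.integral_of_le hq,
    integral_Ioc_eq_integral_Ioo, integral_Ioc_eq_integral_Ioo]
  have h1 : (fun y => if θ ≤ y then f y else 0) = (Set.Ici θ).indicator f := by
    funext y
    simp [Set.indicator]
  rw [h1, setIntegral_indicator measurableSet_Ici]
  rw [← integral_Ico_eq_integral_Ioo (x := θ)]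
  apply setIntegral_congr_set
  have h2 : ∀ᵐ y : ℝ, y ≠ 0 := by simp [ae_iff]
  filter_upwards [h2] with y hy
  apply propext
  change y ∈ Set.Ioo 0 q ∩ Set.Ici θ ↔ y ∈ Set.Ico θ q
  simp only [Set.mem_inter_iff, Set.mem_Ioo, Set.mem_Ici, Set.mem_Ico]
  constructor
  · rintro ⟨⟨_, h⟩, h'⟩
    exact ⟨h', h⟩
  · rintro ⟨h, h'⟩
    exact ⟨⟨lt_of_le_of_ne (h0.trans h) hy.symm, h'⟩, h⟩

lemma aux_sqrt (H θ q : ℝ) (h0 : 0 ≤ θ) (hq : θ ≤ q) :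
    (∫ y in θ..q, H / (2 * Real.sqrt y)) = H * (Real.sqrt q - Real.sqrt θ) := by
  have h1 : (∫ y in θ..q, H / (2 * Real.sqrt y)) = ∫ y in θ..q, (H / 2) * y ^ (-(1/2) : ℝ) := by
    apply intervalIntegral.integral_congr
    intro y hy
    rw [Set.uIcc_of_le hq] at hy
    have : 0 ≤ y := h0.trans hy.1
    simp only
    rw [Real.rpow_neg this, ← Real.sqrt_eq_rpow]
    rw [div_mul_eq_div_div, div_eq_mul_inv (H / 2)]
  rw [h1, intervalIntegral.integral_const_mul, integral_rpow (Or.inl (by norm_num)),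
    Real.sqrt_eq_rpow, Real.sqrt_eq_rpow]
  norm_num
  ring

/-- the two-point-mass value quantile function `v = H·1{y ≥ θ}` with
`θ = ((H − b*)/H)²` satisfies the two-bidder BBM constraint implied by a degenerate maximum
bid `b*`, and has mean `2·b* − (b*)²/H`. -/
theorem bbm_nonsharp_example
    (H bstar : ℝ) (hH : 0 < H) (hb0 : 0 ≤ bstar) (hbH : bstar ≤ H)
    (θ : ℝ) (hθ : θ = ((H - bstar) / H) ^ 2)
    (v : ℝ → ℝ) (hv : v = fun y => if θ ≤ y then H else 0) :
    (∀ q ∈ Set.Ioc (0 : ℝ) 1,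
      (1 / Real.sqrt q) * (∫ y in (0 : ℝ)..q, v y / (2 * Real.sqrt y)) ≤ bstar) ∧
    (∫ y in (0 : ℝ)..1, v y) = 2 * bstar - bstar ^ 2 / H := by
  have ht0 : 0 ≤ θ := by rw [hθ]; positivity
  have hr0 : 0 ≤ (H - bstar) / H := div_nonneg (by linarith) hH.le
  have hr1 : (H - bstar) / H ≤ 1 := by rw [div_le_one hH]; linarith
  have ht1 : θ ≤ 1 := by rw [hθ]; exact pow_le_one₀ hr0 hr1
  have hs : Real.sqrt θ = (H - bstar) / H := by rw [hθ, Real.sqrt_sq hr0]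
  subst hv
  refine ⟨?_, ?_⟩
  · rintro q ⟨hq0, hq1⟩
    by_cases hq : θ ≤ q
    · simp only [ite_div, zero_div]
      rw [aux_cut θ q (fun y => H / (2 * Real.sqrt y)) ht0 hq, aux_sqrt H θ q ht0 hq, hs]
      have hsq : 0 < Real.sqrt q := Real.sqrt_pos.2 hq0
      have hsq1 : Real.sqrt q ≤ 1 := Real.sqrt_le_one.2 hq1
      rw [one_div, inv_mul_le_iff₀ hsq]
      have : H * (Real.sqrt q - (H - bstar) / H) = H * Real.sqrt q - (H - bstar) := by
        field_simp
      rw [this]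
      nlinarith
    · push Not at hq
      have : (∫ y in (0 : ℝ)..q, (if θ ≤ y then H else 0) / (2 * Real.sqrt y)) = 0 := by
        refine Eq.trans ?_ (intervalIntegral.integral_zero (a := 0) (b := q) (μ := volume))
        apply intervalIntegral.integral_congr
        intro y hy
        rw [Set.uIcc_of_le hq0.le] at hy
        have : ¬ θ ≤ y := not_le.2 (lt_of_le_of_lt hy.2 hq)
        simp [this]
      simp only [this, mul_zero]
      exact hb0
  · rw [aux_cut θ 1 (fun _ => H) ht0 ht1, intervalIntegral.integral_const, hθ, smul_eq_mul]
    field_simp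
    ring
end
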